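/- Suppose sequences (x_k), (γ_k), (α_k), (p_k), (Φ_k) are generated by the nonmonotone proximal gradient method with backtracking information, and assume ∇f is locally Lipschitz continuous (every point of X has a neighborhood on which ∇f is Lipschitz). If the set of accumulation points of the sequence (x_k) is nonempty and bounded, then there exists γ̄ > 0 such that γ_k ≥ γ̄ for all k ≥ 1. -/

import Mathlib

open Filter Topology
open scoped RealInnerProductSpace

variable {X : Type*} [NormedAddCommGroup X] [InnerProductSpace ℝ X] [FiniteDimensional ℝ X]

/-- The extended-real-valued composite objective `φ = f + g`. -/
noncomputable def phiE (f : X → ℝ) (g : X → EReal) (z : X) : EReal :=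
  (f z : EReal) + g z

/-- `y` minimizes `z ↦ g z + ⟪v, z - x⟫ + ‖z - x‖² / (2γ)` over `X`
(a proximal gradient step from `x` with gradient vector `v` and stepsize `γ`). -/
def ProxMin (g : X → EReal) (v x : X) (γ : ℝ) (y : X) : Prop :=
  ∀ z : X,
    g y + ((⟪v, y - x⟫ + ‖y - x‖ ^ 2 / (2 * γ) : ℝ) : EReal) ≤
      g z + ((⟪v, z - x⟫ + ‖z - x‖ ^ 2 / (2 * γ) : ℝ) : EReal)

/-- Fréchet (regular) subgradient of `h` at `xb`. -/
noncomputable def FSubgrad (h : X → EReal) (xb v : X) : Prop :=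
  h xb ≠ ⊤ ∧
    0 ≤ Filter.liminf
        (fun z : X => (h z - h xb - ((⟪v, z - xb⟫ : ℝ) : EReal)) / ((‖z - xb‖ : ℝ) : EReal))
        (𝓝[≠] xb)

/-- Limiting (Mordukhovich) subgradient of `h` at `xb`. -/
noncomputable def MSubgrad (h : X → EReal) (xb v : X) : Prop :=
  h xb ≠ ⊤ ∧
    ∃ xs vs : ℕ → X,
      Tendsto xs atTop (𝓝 xb) ∧ Tendsto vs atTop (𝓝 v) ∧
        Tendsto (fun j => h (xs j)) atTop (𝓝 (h xb)) ∧ ∀ j, FSubgrad h (xs j) (vs j)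

/-- The sequences `x, γ, α, p, Φ` are generated by the nonmonotone proximal gradient
method for `φ = f + g` with parameters `γmax, αmin, αmax, pmin`. -/
structure NMPG (f : X → ℝ) (g : X → EReal) (γmax αmin αmax pmin : ℝ)
    (x : ℕ → X) (γ α p : ℕ → ℝ) (Φ : ℕ → ℝ) : Prop where
  hf : ContDiff ℝ 1 f
  hg_nebot : ∀ z, g z ≠ ⊥
  hg_proper : ∃ z, g z ≠ ⊤
  hg_lsc : LowerSemicontinuous g
  hg_proxbdd : ∃ γ₀ : ℝ, 0 < γ₀ ∧ ∃ m : ℝ, ∀ z,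
    (m : EReal) ≤ g z + ((‖z‖ ^ 2 / (2 * γ₀) : ℝ) : EReal)
  hφ_bdd : ∃ m : ℝ, ∀ z, (m : EReal) ≤ phiE f g z
  hγmax : 0 < γmax
  hαmin : 0 < αmin
  hαα : αmin ≤ αmax
  hαmax : αmax < 1
  hpmin : 0 < pmin
  hpone : pmin ≤ 1
  hx0 : g (x 0) ≠ ⊤
  hΦ0 : (Φ 0 : EReal) = phiE f g (x 0)
  hγpos : ∀ k, 0 < γ k
  hγle : ∀ k, γ k ≤ γmax
  hαmem : ∀ k, α k ∈ Set.Icc αmin αmax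
  hpmem : ∀ k, p k ∈ Set.Icc pmin 1
  hstep : ∀ k : ℕ, ProxMin g (gradient f (x k)) (x k) (γ (k + 1)) (x (k + 1))
  hls : ∀ k : ℕ, phiE f g (x (k + 1)) ≤
      ((Φ k - (1 - α (k + 1)) / (2 * γ (k + 1)) * ‖x (k + 1) - x k‖ ^ 2 : ℝ) : EReal)
  hΦrec : ∀ k : ℕ, Φ (k + 1) = (1 - p (k + 1)) * Φ k + p (k + 1) * (phiE f g (x (k + 1))).toReal

/-- Backtracking information: for every `k`, either `γ k ≥ γmin`, or the previously
attempted stepsize `σ ∈ [γ k / βmax, γ k / βmin]` was rejected by the line search. -/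
def Backtrack (f : X → ℝ) (g : X → EReal) (αmin γmin βmin βmax : ℝ)
    (x : ℕ → X) (γ : ℕ → ℝ) (Φ : ℕ → ℝ) : Prop :=
  ∀ k : ℕ, γmin ≤ γ (k + 1) ∨
    ∃ σ : ℝ, ∃ y : X, γ (k + 1) / βmax ≤ σ ∧ σ ≤ γ (k + 1) / βmin ∧
      ProxMin g (gradient f (x k)) (x k) σ y ∧
      ((Φ k - (1 - αmin) / (2 * σ) * ‖y - x k‖ ^ 2 : ℝ) : EReal) < phiE f g y

theorem exists_norm_le_of_accPts_bounded {x : ℕ → X}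
    (hstep : Tendsto (fun k => ‖x (k + 1) - x k‖) atTop (𝓝 0))
    (hne : ({y : X | ∃ ks : ℕ → ℕ, StrictMono ks ∧
      Tendsto (fun j => x (ks j)) atTop (𝓝 y)} : Set X).Nonempty)
    (hbdd : Bornology.IsBounded ({y : X | ∃ ks : ℕ → ℕ, StrictMono ks ∧
      Tendsto (fun j => x (ks j)) atTop (𝓝 y)} : Set X)) :
    ∃ B : ℝ, ∀ k, ‖x k‖ ≤ B := by
  have : ProperSpace X := FiniteDimensional.proper_real X
  obtain ⟨R, hR⟩ := hbdd.exists_norm_le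
  have hannulus : ∀ᶠ n in atTop, ¬ (R + 1 ≤ ‖x n‖ ∧ ‖x n‖ ≤ R + 2) := by
    by_contra hcon
    have hfreq : ∃ᶠ n in atTop, x n ∈ {z : X | R + 1 ≤ ‖z‖ ∧ ‖z‖ ≤ R + 2} := fun hc => hcon hc
    have hb : Bornology.IsBounded {z : X | R + 1 ≤ ‖z‖ ∧ ‖z‖ ≤ R + 2} :=
      Metric.isBounded_closedBall.subset fun z hz => mem_closedBall_zero_iff.2 hz.2
    have hclosed : IsClosed {z : X | R + 1 ≤ ‖z‖ ∧ ‖z‖ ≤ R + 2} :=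
      (isClosed_le continuous_const continuous_norm).inter
        (isClosed_le continuous_norm continuous_const)
    obtain ⟨a, ha, ks, hks, hlim⟩ := tendsto_subseq_of_frequently_bounded hb hfreq
    rw [hclosed.closure_eq] at ha
    have := hR a ⟨ks, hks, hlim⟩
    linarith [ha.1]
  have hsmall : ∀ᶠ n in atTop, ‖x (n + 1) - x n‖ < 1 := hstep.eventually_lt_const one_pos
  obtain ⟨N, hN⟩ := eventually_atTop.1 (hannulus.and hsmall)
  obtain ⟨y, ks, hks, hlim⟩ := hne
  have hy : ‖y‖ < R + 1 := by linarith [hR y ⟨ks, hks, hlim⟩]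
  obtain ⟨j, hj, hjN⟩ := ((hlim.norm.eventually_lt_const hy).and
    (hks.tendsto_atTop.eventually_ge_atTop N)).exists
  have htail : ∀ n, ks j ≤ n → ‖x n‖ < R + 1 := by
    intro n hn
    induction n, hn using Nat.le_induction with
    | base => exact hj
    | succ n hn ih =>
      have h1 := (hN n (hjN.trans hn)).2
      have h2 := (hN (n + 1) (by omega)).1
      have h3 := norm_sub_norm_le (x (n + 1)) (x n)
      by_contra hc
      exact h2 ⟨not_lt.1 hc, by linarith⟩
  have hR0 : 0 ≤ R := (norm_nonneg y).trans (hR y ⟨ks, hks, hlim⟩)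
  refine ⟨R + 1 + ∑ i ∈ Finset.range (ks j), ‖x i‖, fun n => ?_⟩
  rcases le_or_gt (ks j) n with hn | hn
  · have : 0 ≤ ∑ i ∈ Finset.range (ks j), ‖x i‖ := Finset.sum_nonneg fun _ _ => norm_nonneg _
    linarith [htail n hn]
  · have := Finset.single_le_sum (f := fun i => ‖x i‖) (fun i _ => norm_nonneg (x i))
      (Finset.mem_range.2 hn)
    linarith

theorem abs_sub_sub_inner_gradient_le {f : X → ℝ} (hf : Differentiable ℝ f) {s : Set X} {L : NNReal}
    (hL : LipschitzOnWith L (gradient f) s) {a b : X} (hs : segment ℝ a b ⊆ s) :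
    |f b - f a - ⟪gradient f a, b - a⟫| ≤ L * ‖b - a‖ ^ 2 := by
  have hbound : ∀ z ∈ segment ℝ a b, ‖fderiv ℝ f z - fderiv ℝ f a‖ ≤ L * ‖b - a‖ := by
    intro z hz
    have h1 : ‖fderiv ℝ f z - fderiv ℝ f a‖ = ‖gradient f z - gradient f a‖ := by
      rw [← toDual_gradient, ← toDual_gradient, ← map_sub, LinearIsometryEquiv.norm_map]
    have h2 := hL.norm_sub_le (hs hz) (hs (left_mem_segment ℝ a b))
    have h3 : ‖z - a‖ ≤ ‖b - a‖ := by
      obtain ⟨t, ht, rfl⟩ := (segment_eq_image' ℝ a b) ▸ hz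
      simp only [add_sub_cancel_left, norm_smul, Real.norm_eq_abs, abs_of_nonneg ht.1]
      exact mul_le_of_le_one_left (norm_nonneg _) ht.2
    rw [h1]
    exact h2.trans (by gcongr)
  have key := (convex_segment a b).norm_image_sub_le_of_norm_fderiv_le'
    (fun z _ => hf z) hbound (left_mem_segment ℝ a b) (right_mem_segment ℝ a b)
  rw [← toDual_gradient, InnerProductSpace.toDual_apply_apply, Real.norm_eq_abs] at key
  linarith [key, sq ‖b - a‖]

namespace NMPG

variable {f : X → ℝ} {g : X → EReal} {γmax αmin αmax pmin : ℝ}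
  {x : ℕ → X} {γ α p Φ : ℕ → ℝ}

theorem coe_toReal_g (h : NMPG f g γmax αmin αmax pmin x γ α p Φ) (k : ℕ) :
    ((g (x k)).toReal : EReal) = g (x k) := by
  refine EReal.coe_toReal ?_ (h.hg_nebot _)
  rcases k with _ | k
  · exact h.hx0
  · intro htop
    have := h.hls k
    rw [phiE, htop, EReal.coe_add_top] at this
    exact EReal.coe_ne_top _ (top_le_iff.1 this)

theorem phiE_eq (h : NMPG f g γmax αmin αmax pmin x γ α p Φ) (k : ℕ) :
    phiE f g (x k) = ((f (x k) + (g (x k)).toReal : ℝ) : EReal) := by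
  rw [phiE, EReal.coe_add, h.coe_toReal_g]

theorem line_search (h : NMPG f g γmax αmin αmax pmin x γ α p Φ) (k : ℕ) :
    f (x (k + 1)) + (g (x (k + 1))).toReal ≤
      Φ k - (1 - α (k + 1)) / (2 * γ (k + 1)) * ‖x (k + 1) - x k‖ ^ 2 := by
  have := h.hls k
  rw [h.phiE_eq] at this
  exact EReal.coe_le_coe_iff.1 this

theorem merit_succ (h : NMPG f g γmax αmin αmax pmin x γ α p Φ) (k : ℕ) :
    Φ (k + 1) = (1 - p (k + 1)) * Φ k
      + p (k + 1) * (f (x (k + 1)) + (g (x (k + 1))).toReal) := by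
  rw [h.hΦrec k, h.phiE_eq, EReal.toReal_coe]

theorem descent_nonneg (h : NMPG f g γmax αmin αmax pmin x γ α p Φ) (k : ℕ) :
    0 ≤ (1 - α (k + 1)) / (2 * γ (k + 1)) * ‖x (k + 1) - x k‖ ^ 2 := by
  have h1 := (h.hαmem (k + 1)).2
  have h2 := h.hαmax
  have h3 := h.hγpos (k + 1)
  exact mul_nonneg (div_nonneg (by linarith) (by linarith)) (sq_nonneg _)

theorem objective_le_merit (h : NMPG f g γmax αmin αmax pmin x γ α p Φ) (k : ℕ) :
    f (x k) + (g (x k)).toReal ≤ Φ k := by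
  rcases k with _ | k
  · have := h.hΦ0
    rw [h.phiE_eq] at this
    exact (EReal.coe_eq_coe_iff.1 this).ge
  · have h1 := h.line_search k
    have h2 := h.descent_nonneg k
    have h3 := (h.hpmem (k + 1)).2
    rw [h.merit_succ]
    nlinarith

theorem merit_antitone (h : NMPG f g γmax αmin αmax pmin x γ α p Φ) : Antitone Φ := by
  refine antitone_nat_of_succ_le fun k => ?_
  have h1 := h.line_search k
  have h2 := h.descent_nonneg k
  have h3 := (h.hpmem (k + 1)).1
  have h4 := h.hpmin
  rw [h.merit_succ]
  nlinarith

theorem tendsto_norm_step (h : NMPG f g γmax αmin αmax pmin x γ α p Φ) :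
    Tendsto (fun k => ‖x (k + 1) - x k‖) atTop (𝓝 0) := by
  obtain ⟨m, hm⟩ := h.hφ_bdd
  have hlow : ∀ k, m ≤ Φ k := fun k => by
    have := hm (x k)
    rw [h.phiE_eq] at this
    exact (EReal.coe_le_coe_iff.1 this).trans (h.objective_le_merit k)
  have hlim := tendsto_atTop_ciInf h.merit_antitone ⟨m, by rintro _ ⟨k, rfl⟩; exact hlow k⟩
  have hdiff : Tendsto (fun k => Φ k - Φ (k + 1)) atTop (𝓝 0) := by
    simpa using hlim.sub (hlim.comp (tendsto_add_atTop_nat 1))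
  have hαmax := h.hαmax
  have hγmax := h.hγmax
  have hpmin := h.hpmin
  set c : ℝ := pmin * ((1 - αmax) / (2 * γmax)) with hc_def
  have hc : 0 < c := mul_pos hpmin (div_pos (by linarith) (by linarith))
  have hle : ∀ k, ‖x (k + 1) - x k‖ ^ 2 ≤ (Φ k - Φ (k + 1)) / c := by
    intro k
    rw [le_div_iff₀ hc]
    have h1 := h.line_search k
    have h2 := h.descent_nonneg k
    have h3 := h.hpmem (k + 1)
    have h4 := (h.hαmem (k + 1)).2
    have h5 : (1 - αmax) / (2 * γmax) ≤ (1 - α (k + 1)) / (2 * γ (k + 1)) :=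
      div_le_div₀ (by linarith) (by linarith) (by linarith [h.hγpos (k + 1)])
        (by linarith [h.hγle (k + 1)])
    have h6 := mul_le_mul_of_nonneg_right h5 (sq_nonneg ‖x (k + 1) - x k‖)
    have h7 : pmin * ((1 - α (k + 1)) / (2 * γ (k + 1)) * ‖x (k + 1) - x k‖ ^ 2) ≤
        p (k + 1) * ((1 - α (k + 1)) / (2 * γ (k + 1)) * ‖x (k + 1) - x k‖ ^ 2) :=
      mul_le_mul_of_nonneg_right h3.1 h2
    have h8 := mul_le_mul_of_nonneg_left h6 hpmin.le
    have h9 := mul_le_mul_of_nonneg_left h1 (hpmin.le.trans h3.1)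
    have h10 := h.merit_succ k
    rw [hc_def]
    linarith
  have hsq : Tendsto (fun k => ‖x (k + 1) - x k‖ ^ 2) atTop (𝓝 0) :=
    squeeze_zero (fun _ => sq_nonneg _) hle (by simpa using hdiff.div_const c)
  simpa [Real.sqrt_sq (norm_nonneg _)] using hsq.sqrt

end NMPG

/-- Near-minimality of a proximal step with small stepsize forces the step to be short. -/
theorem ProxMin.norm_sub_le_one {g : X → EReal} {v a y : X} {σ γ₀ m R M G : ℝ}
    (hy : ProxMin g v a σ y) (hγ₀ : 0 < γ₀)
    (hm : ∀ z, (m : EReal) ≤ g z + ((‖z‖ ^ 2 / (2 * γ₀) : ℝ) : EReal))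
    (hgy : g y = ((g y).toReal : EReal)) (hga : g a = ((g a).toReal : EReal))
    (hR : ‖a‖ ≤ R) (hM : ‖v‖ ≤ M) (hG : (g a).toReal ≤ G) (hσ : 0 < σ)
    (hsmall : σ * (2 * (1 / γ₀ + M + |G - m + R ^ 2 / γ₀ + M| + 1)) ≤ 1) :
    ‖y - a‖ ≤ 1 := by
  have h1 := hy a
  have h2 := hm y
  rw [hgy] at h2
  rw [hgy, hga] at h1
  norm_cast at h1 h2
  simp only [sub_self, inner_zero_right, norm_zero, ne_eq, OfNat.ofNat_ne_zero,
    not_false_eq_true, zero_pow, zero_div, add_zero] at h1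
  have hr := norm_nonneg (y - a)
  have h3 : ‖y‖ ≤ R + ‖y - a‖ := by
    have := norm_add_le a (y - a)
    rw [add_sub_cancel] at this
    linarith
  have h4 : ‖y‖ ^ 2 / (2 * γ₀) ≤ (R ^ 2 + ‖y - a‖ ^ 2) / γ₀ := by
    rw [div_le_div_iff₀ (by positivity) hγ₀]
    have : ‖y‖ ^ 2 ≤ 2 * (R ^ 2 + ‖y - a‖ ^ 2) := by
      nlinarith [norm_nonneg y, sq_nonneg (R - ‖y - a‖)]
    nlinarith
  have h5 : -(M * ‖y - a‖) ≤ ⟪v, y - a⟫ := by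
    have := (abs_le.1 (abs_real_inner_le_norm v (y - a))).1
    nlinarith
  have hM0 : 0 ≤ M := (norm_nonneg v).trans hM
  have h6 : M * ‖y - a‖ ≤ M * (1 + ‖y - a‖ ^ 2) :=
    mul_le_mul_of_nonneg_left (by nlinarith [sq_nonneg (‖y - a‖ - 1)]) hM0
  set C := |G - m + R ^ 2 / γ₀ + M| with hC
  have hC1 : G - m + R ^ 2 / γ₀ + M ≤ C := le_abs_self _
  have hC0 : 0 ≤ C := abs_nonneg _
  have h7 : (1 / γ₀ + M + C + 1) * ‖y - a‖ ^ 2 ≤ ‖y - a‖ ^ 2 / (2 * σ) := by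
    rw [le_div_iff₀ (by positivity)]
    nlinarith [sq_nonneg ‖y - a‖]
  have h8 : (R ^ 2 + ‖y - a‖ ^ 2) / γ₀ = R ^ 2 / γ₀ + 1 / γ₀ * ‖y - a‖ ^ 2 := by
    field_simp
  rw [h8] at h4
  have h9 : (C + 1) * ‖y - a‖ ^ 2 ≤ C := by nlinarith
  by_contra hcon
  have h10 : 1 < ‖y - a‖ ^ 2 := one_lt_pow₀ (not_le.1 hcon) two_ne_zero
  nlinarith

theorem stmt_13 (f : X → ℝ) (g : X → EReal) (γmax αmin αmax pmin : ℝ)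
    (x : ℕ → X) (γ α p : ℕ → ℝ) (Φ : ℕ → ℝ)
    (h : NMPG f g γmax αmin αmax pmin x γ α p Φ)
    (γmin βmin βmax : ℝ) (hγmin : 0 < γmin) (hβmin : 0 < βmin)
    (hββ : βmin ≤ βmax) (hβmax : βmax < 1)
    (hbt : Backtrack f g αmin γmin βmin βmax x γ Φ)
    (hLip : LocallyLipschitz (gradient f))
    (hacc_ne : ({y : X | ∃ ks : ℕ → ℕ, StrictMono ks ∧ Tendsto (fun j => x (ks j)) atTop (𝓝 y)} : Set X).Nonempty)
    (hacc_bdd : Bornology.IsBounded ({y : X | ∃ ks : ℕ → ℕ, StrictMono ks ∧ Tendsto (fun j => x (ks j)) atTop (𝓝 y)} : Set X)) :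
    ∃ γbar : ℝ, 0 < γbar ∧ ∀ k : ℕ, 1 ≤ k → γbar ≤ γ k := by
  have : ProperSpace X := FiniteDimensional.proper_real X
  obtain ⟨R, hR⟩ := exists_norm_le_of_accPts_bounded h.tendsto_norm_step hacc_ne hacc_bdd
  obtain ⟨γ₀, hγ₀, m, hm⟩ := h.hg_proxbdd
  have hf : Differentiable ℝ f := h.hf.differentiable one_ne_zero
  obtain ⟨L, hL⟩ := (hLip.locallyLipschitzOn (s := Metric.closedBall (0 : X) (R + 1))
    ).exists_lipschitzOnWith_of_compact (isCompact_closedBall 0 (R + 1))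
  obtain ⟨M, hM⟩ := (isCompact_closedBall (0 : X) R).exists_bound_of_continuousOn
    hLip.continuous.continuousOn
  obtain ⟨F, hF⟩ := (isCompact_closedBall (0 : X) R).exists_bound_of_continuousOn
    hf.continuous.continuousOn
  have hx : ∀ k, x k ∈ Metric.closedBall (0 : X) R := fun k => mem_closedBall_zero_iff.2 (hR k)
  have hG : ∀ k, (g (x k)).toReal ≤ Φ 0 + F := fun k => by
    have h1 := h.objective_le_merit k
    have h2 := h.merit_antitone (Nat.zero_le k)
    have h3 := (abs_le.1 (hF _ (hx k))).1
    linarith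
  have hM0 : 0 ≤ M := (norm_nonneg _).trans (hM _ (hx 0))
  set D := 2 * (1 / γ₀ + M + |Φ 0 + F - m + R ^ 2 / γ₀ + M| + 1) with hD
  have hD0 : 0 < D := by positivity
  have hαmin := h.hαmin
  set σ₀ := min (1 / D) (αmin / (2 * (L + 1))) with hσ₀
  have hσ₀pos : 0 < σ₀ := lt_min (by positivity) (by positivity)
  refine ⟨min γmin (βmin * σ₀), by positivity, fun k hk => ?_⟩
  obtain ⟨k, rfl⟩ := Nat.exists_eq_add_of_le' hk
  rcases hbt k with hγ | ⟨σ, y, hσl, hσu, hy, hrej⟩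
  · exact (min_le_left _ _).trans hγ
  refine (min_le_right _ _).trans ?_
  suffices hσ : σ₀ ≤ σ by
    have := (le_div_iff₀ hβmin).1 (hσ.trans hσu)
    linarith
  by_contra! hlt
  have hσ : 0 < σ := (div_pos (h.hγpos _) (hβmin.trans_le hββ)).trans_le hσl
  have hga := h.coe_toReal_g k
  have hya := hy (x k)
  have hgy : g y = ((g y).toReal : EReal) := by
    refine (EReal.coe_toReal (fun htop => ?_) (h.hg_nebot y)).symm
    rw [htop, ← hga, EReal.top_add_coe, ← EReal.coe_add] at hya
    exact EReal.coe_ne_top _ (top_le_iff.1 hya)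
  have hyx : ‖y - x k‖ ≤ 1 := by
    refine hy.norm_sub_le_one hγ₀ hm hgy hga.symm (hR k) (hM _ (hx k)) (hG k) hσ ?_
    exact (le_div_iff₀ hD0).1 (hlt.le.trans (min_le_left _ _))
  have hseg : segment ℝ (x k) y ⊆ Metric.closedBall (0 : X) (R + 1) := by
    refine (convex_closedBall (0 : X) (R + 1)).segment_subset ?_ ?_
    · exact mem_closedBall_zero_iff.2 (by linarith [hR k])
    · have := norm_add_le (x k) (y - x k)
      rw [add_sub_cancel] at this
      exact mem_closedBall_zero_iff.2 (by linarith [hR k])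
  have hdesc := (abs_le.1 (abs_sub_sub_inner_gradient_le hf hL hseg)).2
  rw [phiE, hgy, ← EReal.coe_add, EReal.coe_lt_coe_iff] at hrej
  rw [hgy, ← hga] at hya
  norm_cast at hya
  simp only [sub_self, inner_zero_right, norm_zero, ne_eq, OfNat.ofNat_ne_zero,
    not_false_eq_true, zero_pow, zero_div, add_zero] at hya
  have hmer := h.objective_le_merit k
  have hσL : σ * (2 * (L + 1)) ≤ αmin :=
    (le_div_iff₀ (by positivity)).1 (hlt.le.trans (min_le_right _ _))
  have hcurv : (L : ℝ) * ‖y - x k‖ ^ 2 ≤ αmin / (2 * σ) * ‖y - x k‖ ^ 2 := by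
    refine mul_le_mul_of_nonneg_right ?_ (sq_nonneg _)
    rw [le_div_iff₀ (by positivity)]
    nlinarith
  have hsplit : (1 - αmin) / (2 * σ) * ‖y - x k‖ ^ 2 =
      ‖y - x k‖ ^ 2 / (2 * σ) - αmin / (2 * σ) * ‖y - x k‖ ^ 2 := by ring
  linarith
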